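/- Let k, ℓ be integers with k ≥ 1 and 0 ≤ ℓ ≤ 2k−1, Γ a group, α: 2^Γ → {0,1,…,ℓ} a normalized polymatroidal function, and (G,ψ) a Γ-labeled graph. Then (G,ψ) is f_α-sparse if and only if G is (k,0)-sparse and |C| ≤ f_α(C) for every nonempty C ⊆ E(G) that is a circuit in the (k,ℓ')-count matroid M_{k,ℓ'}(G) for some integer ℓ' with 1 ≤ ℓ' ≤ ℓ. -/

import Mathlib

/- Formalization of count matroids of group-labeled graphs. -/

namespace CountMatroidPaper

attribute [local instance] Classical.propDecidable

/-- A `Γ`-labeled graph: a directed multigraph with edge set `E`, vertex set `V`,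
and a gain (group label) on each edge. -/
structure GainGraph (V E Γ : Type*) where
  tail : E → V
  head : E → V
  gain : E → Γ

variable {V E Γ : Type*}

namespace GainGraph

variable [Group Γ]

/-- `V(F)`: the set of vertices incident to the edge set `F`. -/
def verts [DecidableEq V] (G : GainGraph V E Γ) (F : Finset E) : Finset V :=
  F.image G.tail ∪ F.image G.head

/-- `G.GainWalk F u w g` : there is a walk from `u` to `w` using edges of `F` whose gain is `g`. -/
inductive GainWalk (G : GainGraph V E Γ) (F : Set E) (u : V) : V → Γ → Prop
  | nil : GainWalk G F u u 1
  | fwd {w : V} {g : Γ} {e : E} : GainWalk G F u w g → e ∈ F → G.tail e = w →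
      GainWalk G F u (G.head e) (g * G.gain e)
  | bwd {w : V} {g : Γ} {e : E} : GainWalk G F u w g → e ∈ F → G.head e = w →
      GainWalk G F u (G.tail e) (g * (G.gain e)⁻¹)

/-- An edge set is balanced if every closed walk in it has identity gain. -/
def Balanced (G : GainGraph V E Γ) (F : Set E) : Prop :=
  ∀ (v : V) (g : Γ), G.GainWalk F v v g → g = 1

/-- Membership in `C(G)` : a nonempty edge set `F` such that `(V(F), F)` is connected. -/
def Connected [DecidableEq V] (G : GainGraph V E Γ) (F : Finset E) : Prop :=
  F.Nonempty ∧ ∀ u ∈ G.verts F, ∀ w ∈ G.verts F, ∃ g : Γ, G.GainWalk (↑F) u w g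

/-- The set of gains of closed walks based at `v` using edges of `F`. -/
def gains (G : GainGraph V E Γ) (F : Set E) (v : V) : Set Γ :=
  {g | G.GainWalk F v v g}

/-- `α̃(F)`: the value of `α` on (a generating set of) the subgroup `⟨F⟩_{v,ψ}` for a
vertex `v ∈ V(F)`.  For a polymatroidal `α` (invariant under conjugation and under taking
generated subgroups) this is independent of the choice of `v`. -/
noncomputable def alphaTilde (α : Set Γ → ℤ) (G : GainGraph V E Γ) (F : Finset E) : ℤ :=
  if h : F.Nonempty then α (G.gains (↑F) (G.tail h.choose)) else 0

/-- Loops at `v`. -/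
def loopsAt (G : GainGraph V E Γ) (v : V) : Set E :=
  {e | G.tail e = v ∧ G.head e = v}

/-- Unbalanced (non-identity labeled) loops at `v`, i.e. `L_v \ L_v°`. -/
def unbalancedLoopsAt (G : GainGraph V E Γ) (v : V) : Set E :=
  {e | G.tail e = v ∧ G.head e = v ∧ G.gain e ≠ 1}

/-- `E_v`: edges incident to `v`. -/
def incidentAt (G : GainGraph V E Γ) (v : V) : Set E :=
  {e | G.tail e = v ∨ G.head e = v}

/-- Non-loop edges incident to `v`. -/
def nonloopAt (G : GainGraph V E Γ) (v : V) : Set E :=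
  {e | (G.tail e = v ∨ G.head e = v) ∧ G.tail e ≠ G.head e}

/-- The split of `(G,ψ)` at `v` with respect to the bipartition `{E₁, E₂}` of the non-loop
edges incident to `v`, where `B = E₂`: the vertex `v` is split into `v₁ = Sum.inl v` and
`v₂ = Sum.inr ()`; edges in `B` become incident to `v₂`, the remaining non-loop edges at `v`
to `v₁`; balanced loops at `v` stay loops at `v₁`, and unbalanced loops at `v` become arcs
from `v₁` to `v₂`, keeping the labeling. -/
noncomputable def split (G : GainGraph V E Γ) (v : V) (B : Set E) :
    GainGraph (V ⊕ Unit) E Γ where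
  tail e :=
    if G.tail e = v ∧ G.head e = v then Sum.inl v
    else if G.tail e = v ∧ e ∈ B then Sum.inr ()
    else Sum.inl (G.tail e)
  head e :=
    if G.tail e = v ∧ G.head e = v then
      (if G.gain e = 1 then Sum.inl v else Sum.inr ())
    else if G.head e = v ∧ e ∈ B then Sum.inr ()
    else Sum.inl (G.head e)
  gain := G.gain

/-- `v` is a base for the near-balancedness of `F`, witnessed by the part `B` of the
bipartition of the non-loop edges at `v`: the corresponding split makes `F` balanced. -/
def IsSplitBase (G : GainGraph V E Γ) (F : Finset E) (v : V) (B : Set E) : Prop :=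
  B ⊆ G.nonloopAt v ∧ Balanced (G.split v B) (↑F)

/-- A connected edge set is near-balanced if it is unbalanced and some split of `(G,ψ)`
makes it balanced. -/
def NearBalanced (G : GainGraph V E Γ) (F : Finset E) : Prop :=
  ¬ G.Balanced (↑F) ∧ ∃ (v : V) (B : Set E), G.IsSplitBase F v B

/-- `K` is an extra edge set for the near-balancedness of `F` with base `v`:
`K = E₂ ∪ (L_v \ L_v°)` (or `E₁ ∪ (L_v \ L_v°)`) for a balanced split at `v` with
bipartition `{E₁, E₂}`. -/
def ExtraEdgeSet (G : GainGraph V E Γ) (F : Finset E) (v : V) (K : Set E) : Prop :=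
  ∃ B : Set E, G.IsSplitBase F v B ∧
    (K = B ∪ G.unbalancedLoopsAt v ∨
     K = (G.nonloopAt v \ B) ∪ G.unbalancedLoopsAt v)

/-- `β(F)`. -/
noncomputable def beta (α : Set Γ → ℤ) (k : ℤ) [DecidableEq V]
    (G : GainGraph V E Γ) (F : Finset E) : ℤ :=
  if G.NearBalanced F then min (alphaTilde α G F) k else alphaTilde α G F

/-- `f_α(F) = k|V(F)| - ℓ + β(F)`. -/
noncomputable def fAlpha (α : Set Γ → ℤ) (k ℓ : ℤ) [DecidableEq V]
    (G : GainGraph V E Γ) (F : Finset E) : ℤ :=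
  k * ((G.verts F).card : ℤ) - ℓ + beta α k G F

/-- `I` is `f_α`-sparse: `|F| ≤ f_α(F)` for every `F ∈ C(G)` with `F ⊆ I`. -/
def Sparse (α : Set Γ → ℤ) (k ℓ : ℤ) [DecidableEq V]
    (G : GainGraph V E Γ) (I : Finset E) : Prop :=
  ∀ F : Finset E, F ⊆ I → G.Connected F → (F.card : ℤ) ≤ fAlpha α k ℓ G F

/-- `F` is `f_α`-tight: connected, `f_α`-sparse, with `|F| = f_α(F)`. -/
def Tight (α : Set Γ → ℤ) (k ℓ : ℤ) [DecidableEq V]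
    (G : GainGraph V E Γ) (F : Finset E) : Prop :=
  G.Connected F ∧ Sparse α k ℓ G F ∧ (F.card : ℤ) = fAlpha α k ℓ G F

/-- An edge set `Y` is `f_α`-full: the subgraph `(V(Y), Y)` contains a spanning connected
`f_α`-sparse subgraph `G'` with `β(E(G')) = β(Y)` and
`|E(G')| ≥ k|V(G')| - ℓ + min{β(E(G')), 2k - ℓ + 1}`. -/
def Full (α : Set Γ → ℤ) (k ℓ : ℤ) [DecidableEq V]
    (G : GainGraph V E Γ) (Y : Finset E) : Prop :=
  ∃ E' : Finset E, E' ⊆ Y ∧ G.Connected E' ∧ G.verts E' = G.verts Y ∧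
    Sparse α k ℓ G E' ∧ beta α k G E' = beta α k G Y ∧
    k * ((G.verts E').card : ℤ) - ℓ + min (beta α k G E') (2 * k - ℓ + 1) ≤ (E'.card : ℤ)

/-- The graph `(G,ψ)` is `f_α`-full: it contains a spanning connected `f_α`-sparse
subgraph `G'` with `β(E(G')) = β(E(G))` and
`|E(G')| ≥ k|V(G')| - ℓ + min{β(E(G')), 2k - ℓ + 1}`. -/
def FullGraph [Fintype V] [Fintype E] [DecidableEq V]
    (α : Set Γ → ℤ) (k ℓ : ℤ) (G : GainGraph V E Γ) : Prop :=
  ∃ E' : Finset E, G.Connected E' ∧ G.verts E' = Finset.univ ∧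
    Sparse α k ℓ G E' ∧ beta α k G E' = beta α k G (Finset.univ : Finset E) ∧
    k * ((G.verts E').card : ℤ) - ℓ + min (beta α k G E') (2 * k - ℓ + 1) ≤ (E'.card : ℤ)

/-- `F` is `α`-critical: connected, near-balanced, and `α̃(F) > k`. -/
def AlphaCritical (α : Set Γ → ℤ) (k : ℤ) [DecidableEq V]
    (G : GainGraph V E Γ) (F : Finset E) : Prop :=
  G.Connected F ∧ G.NearBalanced F ∧ k < alphaTilde α G F

/-- Switching at `v` with `g`. -/
noncomputable def switch (G : GainGraph V E Γ) (v : V) (g : Γ) : GainGraph V E Γ where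
  tail := G.tail
  head := G.head
  gain e :=
    if G.tail e = v ∧ G.head e = v then g * G.gain e * g⁻¹
    else if G.tail e = v then g * G.gain e
    else if G.head e = v then G.gain e * g⁻¹
    else G.gain e

/-- Two gain functions (on the same underlying graph) are equivalent if one is obtained
from the other by a sequence of switchings. -/
def Equivalent (G G' : GainGraph V E Γ) : Prop :=
  Relation.ReflTransGen (fun H H' : GainGraph V E Γ => ∃ (v : V) (g : Γ), H' = H.switch v g) G G'

/-- The label of the edge `e`, re-oriented so that `e` is directed towards `v`. -/
noncomputable def orientTo (G : GainGraph V E Γ) (v : V) (e : E) : Γ :=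
  if G.head e = v then G.gain e else (G.gain e)⁻¹

/-- Adjacency in `G - v`. -/
def AdjAvoid (G : GainGraph V E Γ) (v u w : V) : Prop :=
  u ≠ v ∧ w ≠ v ∧ ∃ e : E, (G.tail e = u ∧ G.head e = w) ∨ (G.tail e = w ∧ G.head e = u)

/-- `S` is (the edge set of) a fraction of `v`: the subgraph of `G - L_v` induced by `v`
together with the vertex set of a connected component of `G - v`. -/
def IsFraction [Fintype E] (G : GainGraph V E Γ) (v : V) (S : Finset E) : Prop :=
  ∃ u : V, u ≠ v ∧
    S = Finset.univ.filter (fun e =>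
      ¬ (G.tail e = v ∧ G.head e = v) ∧
      (G.tail e = v ∨ Relation.ReflTransGen (G.AdjAvoid v) u (G.tail e)) ∧
      (G.head e = v ∨ Relation.ReflTransGen (G.AdjAvoid v) u (G.head e)))

/-- `I` is `(k,m)`-sparse: `|F| ≤ k|V(F)| - m` for every nonempty `F ⊆ I`. -/
def CountSparse [DecidableEq V] (G : GainGraph V E Γ) (k m : ℤ) (I : Finset E) : Prop :=
  ∀ F : Finset E, F ⊆ I → F.Nonempty → (F.card : ℤ) ≤ k * ((G.verts F).card : ℤ) - m

/-- `C` is a circuit of the `(k,m)`-count matroid `M_{k,m}(G)`: a minimal set that is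
not `(k,m)`-sparse. -/
def CountCircuit [DecidableEq V] (G : GainGraph V E Γ) (k m : ℤ) (C : Finset E) : Prop :=
  ¬ G.CountSparse k m C ∧ ∀ C' : Finset E, C' ⊆ C → C' ≠ C → G.CountSparse k m C'

end GainGraph

/-- `α : 2^Γ → ℤ` is polymatroidal. -/
structure Polymatroidal [Group Γ] (α : Set Γ → ℤ) : Prop where
  empty : α ∅ = 0
  submodular : ∀ X Y : Set Γ, α (X ∪ Y) + α (X ∩ Y) ≤ α X + α Y
  mono : ∀ X Y : Set Γ, X ⊆ Y → α X ≤ α Y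
  conj : ∀ (X : Set Γ) (γ : Γ), α ((fun x => γ * x * γ⁻¹) '' X) = α X
  clos : ∀ X : Set Γ, α ((Subgroup.closure X : Subgroup Γ) : Set Γ) = α X

/-- A polymatroidal function is normalized if `α({g}) ≠ 0` for every non-identity `g`
and `α({1}) = 0`. -/
def Normalized [Group Γ] (α : Set Γ → ℤ) : Prop :=
  (∀ g : Γ, g ≠ 1 → α {g} ≠ 0) ∧ α ({1} : Set Γ) = 0

/-- The smoothness condition: `α(S ∪ {g}) - α(S) > k` implies `S = {1}` and `g² ≠ 1`. -/
def Smooth [Group Γ] (α : Set Γ → ℤ) (k : ℤ) : Prop :=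
  ∀ (S : Set Γ) (g : Γ), S.Nonempty → k < α (S ∪ {g}) - α S →
    S = ({1} : Set Γ) ∧ g ^ 2 ≠ 1


namespace GainGraph

lemma mem_verts [DecidableEq V] {G : GainGraph V E Γ} {F : Finset E} {v : V} :
    v ∈ G.verts F ↔ ∃ e ∈ F, G.tail e = v ∨ G.head e = v := by
  simp only [verts, Finset.mem_union, Finset.mem_image]
  grind

lemma tail_mem_verts [DecidableEq V] {G : GainGraph V E Γ} {F : Finset E} {e : E} (he : e ∈ F) :
    G.tail e ∈ G.verts F :=
  mem_verts.2 ⟨e, he, Or.inl rfl⟩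

lemma CountCircuit.lt_card [DecidableEq V] {G : GainGraph V E Γ} {k m : ℤ} {C : Finset E}
    (hC : G.CountCircuit k m C) :
    C.Nonempty ∧ k * ((G.verts C).card : ℤ) - m < C.card := by
  have hns := hC.1
  simp only [CountSparse, not_forall, not_le] at hns
  obtain ⟨F, hFC, hne, hlt⟩ := hns
  by_cases hEq : F = C
  · subst hEq
    exact ⟨hne, hlt⟩
  · exact absurd (hC.2 F hFC hEq F subset_rfl hne) hlt.not_ge

lemma exists_countCircuit_subset [DecidableEq V] {G : GainGraph V E Γ} {k m : ℤ}
    {F : Finset E} (hF : ¬ G.CountSparse k m F) : ∃ C ⊆ F, G.CountCircuit k m C := by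
  induction F using Finset.strongInduction with
  | H F ih =>
    by_cases h : ∀ C' : Finset E, C' ⊆ F → C' ≠ F → G.CountSparse k m C'
    · exact ⟨F, subset_rfl, hF, h⟩
    · push Not at h
      obtain ⟨C', hsub, hne, hns⟩ := h
      obtain ⟨C, hC, hcirc⟩ := ih C' (hsub.ssubset_of_ne hne) hns
      exact ⟨C, hC.trans hsub, hcirc⟩

variable [Group Γ]

namespace GainWalk

variable {G : GainGraph V E Γ} {F F' : Set E} {u v w : V} {g h : Γ}

lemma mono (hF : F ⊆ F') (p : G.GainWalk F u w g) : G.GainWalk F' u w g := by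
  induction p with
  | nil => exact .nil
  | fwd _ he ht ih => exact .fwd ih (hF he) ht
  | bwd _ he ht ih => exact .bwd ih (hF he) ht

lemma trans (p : G.GainWalk F u v g) (q : G.GainWalk F v w h) :
    G.GainWalk F u w (g * h) := by
  induction q with
  | nil => simpa using p
  | fwd _ he ht ih => simpa only [mul_assoc] using GainWalk.fwd ih he ht
  | bwd _ he ht ih => simpa only [mul_assoc] using GainWalk.bwd ih he ht

lemma reverse (p : G.GainWalk F u w g) : G.GainWalk F w u g⁻¹ := by
  induction p with
  | nil => simpa using GainWalk.nil
  | @fwd _ g e _ he ht ih =>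
    subst ht
    simpa using (GainWalk.bwd .nil he rfl).trans ih
  | @bwd _ g e _ he ht ih =>
    subst ht
    simpa using (GainWalk.fwd .nil he rfl).trans ih

end GainWalk

lemma Balanced.mono {G : GainGraph V E Γ} {F F' : Set E} (hF : F ⊆ F') (h : G.Balanced F') :
    G.Balanced F :=
  fun v g p => h v g (p.mono hF)

lemma alphaTilde_nonneg {α : Set Γ → ℤ} (h0 : ∀ X, 0 ≤ α X) (G : GainGraph V E Γ)
    (F : Finset E) : 0 ≤ alphaTilde α G F := by
  unfold alphaTilde
  split_ifs
  exacts [h0 _, le_rfl]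

lemma alphaTilde_of_balanced {α : Set Γ → ℤ} (h1 : α {1} = 0) {G : GainGraph V E Γ}
    {F : Finset E} (hF : G.Balanced (F : Set E)) : alphaTilde α G F = 0 := by
  unfold alphaTilde
  split_ifs
  · rw [← h1]
    congr 1
    ext g
    exact ⟨fun hg => hF _ g hg, fun hg => by rw [Set.mem_singleton_iff.1 hg]; exact .nil⟩
  · rfl

lemma alphaTilde_mono [DecidableEq V] {α : Set Γ → ℤ} (hpoly : Polymatroidal α)
    {G : GainGraph V E Γ} {C F : Finset E} (hC : C.Nonempty) (hCF : C ⊆ F)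
    (hF : G.Connected F) : alphaTilde α G C ≤ alphaTilde α G F := by
  unfold alphaTilde
  rw [dif_pos hC, dif_pos hF.1]
  obtain ⟨g, p⟩ := hF.2 _ (tail_mem_verts (hCF hC.choose_spec)) _
    (tail_mem_verts hF.1.choose_spec)
  rw [← hpoly.conj (G.gains F (G.tail hF.1.choose)) g]
  refine hpoly.mono _ _ fun x hx => ⟨g⁻¹ * x * g, ?_, by group⟩
  exact (p.reverse.trans (GainWalk.mono (Finset.coe_subset.2 hCF) hx)).trans p

lemma beta_le_alphaTilde [DecidableEq V] (α : Set Γ → ℤ) (k : ℤ) (G : GainGraph V E Γ)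
    (F : Finset E) : beta α k G F ≤ alphaTilde α G F := by
  unfold beta
  split_ifs
  exacts [min_le_left _ _, le_rfl]

lemma beta_nonneg [DecidableEq V] {α : Set Γ → ℤ} {k : ℤ} (hk : 0 ≤ k) (h0 : ∀ X, 0 ≤ α X)
    (G : GainGraph V E Γ) (F : Finset E) : 0 ≤ beta α k G F := by
  have := alphaTilde_nonneg h0 G F
  unfold beta
  split_ifs
  exacts [le_min this hk, this]

lemma beta_le [DecidableEq V] {α : Set Γ → ℤ} {ℓ : ℤ} (hl : 0 ≤ ℓ) (h : ∀ X, α X ≤ ℓ) (k : ℤ)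
    (G : GainGraph V E Γ) (F : Finset E) : beta α k G F ≤ ℓ := by
  refine (beta_le_alphaTilde α k G F).trans ?_
  unfold alphaTilde
  split_ifs
  exacts [h _, hl]

lemma beta_mono [DecidableEq V] {α : Set Γ → ℤ} {k : ℤ} (hk : 0 ≤ k)
    (hpoly : Polymatroidal α) (h0 : ∀ X, 0 ≤ α X) (h1 : α {1} = 0)
    {G : GainGraph V E Γ} {C F : Finset E} (hC : C.Nonempty) (hCF : C ⊆ F)
    (hF : G.Connected F) : beta α k G C ≤ beta α k G F := by
  have hm := alphaTilde_mono hpoly hC hCF hF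
  by_cases hb : G.Balanced (C : Set E)
  · calc
      beta α k G C ≤ alphaTilde α G C := beta_le_alphaTilde α k G C
      _ = 0 := alphaTilde_of_balanced h1 hb
      _ ≤ beta α k G F := beta_nonneg hk h0 G F
  by_cases hn : G.NearBalanced F
  · obtain ⟨v, B, hB, hs⟩ := hn.2
    have hnC : G.NearBalanced C := ⟨hb, v, B, hB, hs.mono (Finset.coe_subset.2 hCF)⟩
    rw [beta, beta, if_pos hn, if_pos hnC]
    exact min_le_min_right k hm
  · rw [beta.eq_def α k G F, if_neg hn]
    exact (beta_le_alphaTilde α k G C).trans hm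

/-- A nonempty disconnected edge set splits into two vertex-disjoint nonempty parts. -/
lemma exists_separation [DecidableEq V] {G : GainGraph V E Γ} {F : Finset E}
    (hne : F.Nonempty) (hF : ¬ G.Connected F) :
    ∃ F₁ F₂ : Finset E, F₁ ⊂ F ∧ F₂ ⊂ F ∧ F₁.Nonempty ∧ F₂.Nonempty ∧
      F₁.card + F₂.card = F.card ∧
      (G.verts F₁).card + (G.verts F₂).card = (G.verts F).card := by
  simp only [Connected, hne, true_and, not_forall] at hF
  obtain ⟨u, hu, w, hw, huw⟩ := hF
  set R : V → Prop := fun x => ∃ g, G.GainWalk (F : Set E) u x g with hR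
  have hRe : ∀ e ∈ F, (R (G.tail e) ↔ R (G.head e)) := fun e he =>
    ⟨fun ⟨_, p⟩ => ⟨_, .fwd p he rfl⟩, fun ⟨_, p⟩ => ⟨_, .bwd p he rfl⟩⟩
  have hRu : R u := ⟨1, .nil⟩
  have hRw : ¬ R w := huw
  obtain ⟨e₁, he₁, hue₁⟩ := mem_verts.1 hu
  obtain ⟨e₂, he₂, hwe₂⟩ := mem_verts.1 hw
  have h₁ : R (G.tail e₁) := by grind
  have h₂ : ¬ R (G.tail e₂) := by grind
  refine ⟨F.filter fun e => R (G.tail e), F.filter fun e => ¬ R (G.tail e),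
    Finset.filter_ssubset.2 ⟨e₂, he₂, h₂⟩, Finset.filter_ssubset.2 ⟨e₁, he₁, not_not.2 h₁⟩,
    ⟨e₁, Finset.mem_filter.2 ⟨he₁, h₁⟩⟩, ⟨e₂, Finset.mem_filter.2 ⟨he₂, h₂⟩⟩,
    Finset.card_filter_add_card_filter_not _, ?_⟩
  have hv₁ : G.verts (F.filter fun e => R (G.tail e)) = (G.verts F).filter R := by
    ext x
    simp only [mem_verts, Finset.mem_filter]
    grind
  have hv₂ : G.verts (F.filter fun e => ¬ R (G.tail e)) = (G.verts F).filter (¬ R ·) := by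
    ext x
    simp only [mem_verts, Finset.mem_filter]
    grind
  rw [hv₁, hv₂, Finset.card_filter_add_card_filter_not]

lemma Sparse.countSparse [DecidableEq V] {α : Set Γ → ℤ} {k ℓ : ℤ} (hl : 0 ≤ ℓ)
    (h : ∀ X, α X ≤ ℓ) {G : GainGraph V E Γ} {I : Finset E} (hI : Sparse α k ℓ G I) :
    G.CountSparse k 0 I := by
  intro F
  induction F using Finset.strongInduction with
  | H F ih =>
    intro hFI hne
    by_cases hF : G.Connected F
    · have := hI F hFI hF
      have := beta_le hl h k G F
      unfold fAlpha at *
      linarith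
    · obtain ⟨F₁, F₂, h₁, h₂, hn₁, hn₂, hcard, hverts⟩ := exists_separation hne hF
      have i₁ := ih F₁ h₁ (h₁.subset.trans hFI) hn₁
      have i₂ := ih F₂ h₂ (h₂.subset.trans hFI) hn₂
      rw [← hcard, ← hverts]
      push_cast
      linarith

lemma CountCircuit.connected [DecidableEq V] {G : GainGraph V E Γ} {k m : ℤ} (hm : 0 ≤ m)
    {C : Finset E} (hC : G.CountCircuit k m C) : G.Connected C := by
  obtain ⟨hne, hlt⟩ := hC.lt_card
  by_contra hcon
  obtain ⟨F₁, F₂, h₁, h₂, hn₁, hn₂, hcard, hverts⟩ := exists_separation hne hcon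
  have i₁ := hC.2 F₁ h₁.subset h₁.ne F₁ subset_rfl hn₁
  have i₂ := hC.2 F₂ h₂.subset h₂.ne F₂ subset_rfl hn₂
  rw [← hcard, ← hverts] at hlt
  push_cast at hlt
  linarith

end GainGraph

/-- Lemma 9: `(G,ψ)` is `f_α`-sparse iff `G` is `(k,0)`-sparse and
`|C| ≤ f_α(C)` for every nonempty `C ⊆ E(G)` that is a circuit of the `(k,ℓ')`-count
matroid `M_{k,ℓ'}(G)` for some `1 ≤ ℓ' ≤ ℓ`. -/
theorem statement17 {V E Γ : Type} [Fintype V] [DecidableEq V] [Fintype E] [DecidableEq E]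
    [Group Γ] (k ℓ : ℤ) (hk : 1 ≤ k) (hl0 : 0 ≤ ℓ) (hl : ℓ ≤ 2 * k - 1)
    (α : Set Γ → ℤ) (hpoly : Polymatroidal α) (hnorm : Normalized α)
    (hrange : ∀ X : Set Γ, 0 ≤ α X ∧ α X ≤ ℓ)
    (G : GainGraph V E Γ) :
    GainGraph.Sparse α k ℓ G (Finset.univ : Finset E) ↔
      (G.CountSparse k 0 (Finset.univ : Finset E) ∧
       ∀ ℓ' : ℤ, 1 ≤ ℓ' → ℓ' ≤ ℓ → ∀ C : Finset E, C.Nonempty →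
         G.CountCircuit k ℓ' C → (C.card : ℤ) ≤ GainGraph.fAlpha α k ℓ G C) := by
  have h0 : ∀ X, 0 ≤ α X := fun X => (hrange X).1
  have hle : ∀ X, α X ≤ ℓ := fun X => (hrange X).2
  have hk0 : 0 ≤ k := by linarith
  constructor
  · intro hs
    exact ⟨hs.countSparse hl0 hle, fun ℓ' h1 _ C _ hC =>
      hs C (Finset.subset_univ C) (hC.connected (by linarith))⟩
  · rintro ⟨hcount, hcirc⟩ F - hF
    by_contra! hlt
    have hcF := hcount F (Finset.subset_univ F) hF.1
    have hns : ¬ G.CountSparse k (ℓ - GainGraph.beta α k G F) F := fun h => by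
      have := h F subset_rfl hF.1
      unfold GainGraph.fAlpha at hlt
      linarith
    obtain ⟨C, hCF, hC⟩ := GainGraph.exists_countCircuit_subset hns
    obtain ⟨hne, hClt⟩ := hC.lt_card
    have hβ0 := GainGraph.beta_nonneg hk0 h0 G F
    have hβ := GainGraph.beta_mono hk0 hpoly h0 hnorm.2 hne hCF hF
    have hpos : 1 ≤ ℓ - GainGraph.beta α k G F := by
      unfold GainGraph.fAlpha at hlt
      have : 0 < ℓ - GainGraph.beta α k G F := by linarith
      omega
    have hCle := hcirc _ hpos (by linarith) C hne hC
    unfold GainGraph.fAlpha at hCle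
    linarith

end CountMatroidPaper
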